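/- Let d be a positive integer, M ≥ 1, T > 0, let A be a real d×d matrix, H a real p×d matrix, and R a real symmetric positive definite p×p matrix. Suppose δ^{(1)}, …, δ^{(M)} : [0,T] → ℝ^d are differentiable, satisfy Σ_{i=1}^M δ^{(i)}(t) = 0 for all t, and each satisfies (δ^{(i)})'(t) = (A − ½ C(t) Hᵀ R^{-1} H) δ^{(i)}(t), where C(t) = (1/M) Σ_{j=1}^M δ^{(j)}(t) δ^{(j)}(t)ᵀ. Then C is differentiable and satisfies the matrix Riccati differential equation C'(t) = A C(t) + C(t) Aᵀ − C(t) Hᵀ R^{-1} H C(t) for all t ∈ [0,T]. In particular, the empirical covariance of the ensemble Kalman–Bucy filter ensemble evolves exactly according to the Kalman–Bucy covariance Riccati equation, regardless of the ensemble size M. -/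

import Mathlib

open Matrix

attribute [local instance] Matrix.normedAddCommGroup Matrix.normedSpace

/-- The outer product of a differentiable curve with itself obeys the Leibniz rule. -/
lemma hasDerivAt_vecMulVec_self {n : Type*} [Fintype n] {v : ℝ → n → ℝ} {v' : n → ℝ} {t : ℝ}
    (hv : HasDerivAt v v' t) :
    HasDerivAt (fun s => vecMulVec (v s) (v s)) (vecMulVec v' (v t) + vecMulVec (v t) v') t := by
  refine hasDerivAt_pi.2 fun a => hasDerivAt_pi.2 fun b => ?_
  exact (hasDerivAt_pi.1 hv a).mul (hasDerivAt_pi.1 hv b)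

/-- The Lyapunov expression `B P + P Bᵀ` for the empirical second moment `P = c ∑ⱼ vⱼ vⱼᵀ`,
written as a sum over the members `vⱼ`. -/
lemma smul_sum_vecMulVec_mulVec {n ι : Type*} [Fintype n] [Fintype ι]
    (c : ℝ) (B : Matrix n n ℝ) (v : ι → n → ℝ) :
    c • ∑ j, (vecMulVec (B *ᵥ v j) (v j) + vecMulVec (v j) (B *ᵥ v j)) =
      B * (c • ∑ j, vecMulVec (v j) (v j)) + (c • ∑ j, vecMulVec (v j) (v j)) * Bᵀ := by
  simp only [Finset.sum_add_distrib, smul_add, Matrix.mul_smul, Matrix.smul_mul, Matrix.mul_sum,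
    Matrix.sum_mul, mul_vecMulVec, vecMulVec_mul, vecMul_transpose]

/-- If the ensemble deviations `δ⁽ⁱ⁾` sum to zero and each satisfies the homogeneous
EnKBF deviation equation `(δ⁽ⁱ⁾)' = (A − ½ C Hᵀ R⁻¹ H) δ⁽ⁱ⁾`, where
`C = (1/M) Σ_j δ⁽ʲ⁾ (δ⁽ʲ⁾)ᵀ` is the empirical covariance, then `C` is differentiable and
satisfies the Kalman–Bucy covariance Riccati equation
`C' = A C + C Aᵀ − C Hᵀ R⁻¹ H C`, regardless of the ensemble size `M`. -/
theorem enkbf_covariance_riccati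
    (d p M : ℕ) (hd : 0 < d) (hM : 1 ≤ M) (T : ℝ) (hT : 0 < T)
    (A : Matrix (Fin d) (Fin d) ℝ) (H : Matrix (Fin p) (Fin d) ℝ)
    (R : Matrix (Fin p) (Fin p) ℝ) (hR : R.PosDef)
    (δ δ' : Fin M → ℝ → Fin d → ℝ)
    (C : ℝ → Matrix (Fin d) (Fin d) ℝ)
    (hC : ∀ t, C t = (M : ℝ)⁻¹ • ∑ j : Fin M, vecMulVec (δ j t) (δ j t))
    (hsum : ∀ t, ∑ i : Fin M, δ i t = 0)
    (hdiff : ∀ i, ∀ t ∈ Set.Icc (0 : ℝ) T, HasDerivAt (δ i) (δ' i t) t)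
    (hODE : ∀ i, ∀ t ∈ Set.Icc (0 : ℝ) T,
      δ' i t = (A - (2 : ℝ)⁻¹ • (C t * Hᵀ * R⁻¹ * H)) *ᵥ δ i t) :
    ∀ t ∈ Set.Icc (0 : ℝ) T,
      HasDerivAt C (A * C t + C t * Aᵀ - C t * Hᵀ * R⁻¹ * H * C t) t := by
  intro t ht
  have hCt : (C t)ᵀ = C t := by
    simp [hC, transpose_sum, transpose_vecMulVec]
  have hRt : (R⁻¹)ᵀ = R⁻¹ := by
    have hRsymm : Rᵀ = R := by simpa using hR.isHermitian.eq
    rw [transpose_nonsing_inv, hRsymm]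
  have hderiv := (HasDerivAt.fun_sum (u := Finset.univ)
    fun j _ => hasDerivAt_vecMulVec_self (hdiff j t ht)).const_smul (M : ℝ)⁻¹
  have hRiccati : (M : ℝ)⁻¹ • ∑ j, (vecMulVec (δ' j t) (δ j t) + vecMulVec (δ j t) (δ' j t)) =
      A * C t + C t * Aᵀ - C t * Hᵀ * R⁻¹ * H * C t := by
    simp only [hODE _ t ht]
    rw [smul_sum_vecMulVec_mulVec, ← hC t]
    simp only [transpose_sub, transpose_smul, transpose_mul, transpose_transpose, hCt, hRt,
      Matrix.sub_mul, Matrix.mul_sub, Matrix.smul_mul, Matrix.mul_smul, Matrix.mul_assoc]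
    module
  rw [hRiccati] at hderiv
  have hCfun : C = (M : ℝ)⁻¹ • fun s => ∑ j, vecMulVec (δ j s) (δ j s) := funext hC
  rw [← hCfun] at hderiv
  exact hderiv
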